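/- Let G be a finite simple very well-covered graph. Then the family Ψ(G) of local maximum stable sets of G forms a greedoid on the vertex set of G if and only if G has a unique perfect matching. -/

import Mathlib

open Classical

variable {V : Type*} [Fintype V] [DecidableEq V]

/-- `S` is a stable (independent) set of vertices in `G`. -/
def IsStable (G : SimpleGraph V) (S : Finset V) : Prop :=
  ∀ ⦃x⦄, x ∈ S → ∀ ⦃y⦄, y ∈ S → ¬G.Adj x y

/-- The open neighborhood `N(S)`: vertices outside `S` having a neighbor in `S`. -/
noncomputable def nbhd (G : SimpleGraph V) (S : Finset V) : Finset V :=
  Finset.univ.filter fun v => v ∉ S ∧ ∃ u ∈ S, G.Adj u v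

/-- The closed neighborhood `N[S] = S ∪ N(S)`. -/
noncomputable def closedNbhd (G : SimpleGraph V) (S : Finset V) : Finset V :=
  S ∪ nbhd G S

/-- The stability (independence) number of the subgraph of `G` induced by `A`. -/
noncomputable def alphaOn (G : SimpleGraph V) (A : Finset V) : ℕ :=
  sSup {n | ∃ S ⊆ A, IsStable G S ∧ S.card = n}

/-- The stability (independence) number `α(G)`. -/
noncomputable def alpha (G : SimpleGraph V) : ℕ :=
  alphaOn G Finset.univ

/-- `S` is a maximum stable set of the subgraph of `G` induced by `N[S]`. -/
def IsLocalMaxStable (G : SimpleGraph V) (S : Finset V) : Prop :=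
  IsStable G S ∧ S.card = alphaOn G (closedNbhd G S)

/-- `Ψ(G)`: the family of all local maximum stable sets of `G`. -/
def Psi (G : SimpleGraph V) : Set (Finset V) :=
  {S | IsLocalMaxStable G S}

/-- A matching of `G`: a set of pairwise disjoint edges of `G`. -/
def IsGMatching (G : SimpleGraph V) (M : Finset (Sym2 V)) : Prop :=
  (∀ e ∈ M, e ∈ G.edgeSet) ∧
    ∀ e ∈ M, ∀ f ∈ M, e ≠ f → ∀ v : V, v ∈ e → v ∉ f

/-- A matching of `G` all of whose edges have both endpoints inside `A`,
i.e. a matching of the subgraph of `G` induced by `A`. -/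
def IsGMatchingOn (G : SimpleGraph V) (A : Finset V) (M : Finset (Sym2 V)) : Prop :=
  IsGMatching G M ∧ ∀ e ∈ M, ∀ v : V, v ∈ e → v ∈ A

/-- The matching number of the subgraph of `G` induced by `A`. -/
noncomputable def muOn (G : SimpleGraph V) (A : Finset V) : ℕ :=
  sSup {n | ∃ M, IsGMatchingOn G A M ∧ M.card = n}

/-- The matching number `μ(G)`. -/
noncomputable def mu (G : SimpleGraph V) : ℕ :=
  muOn G Finset.univ

/-- A maximum matching of `G`. -/
def IsMaximumGMatching (G : SimpleGraph V) (M : Finset (Sym2 V)) : Prop :=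
  IsGMatching G M ∧ M.card = mu G

/-- The matching `M` saturates the vertex `v`. -/
def MSaturates (M : Finset (Sym2 V)) (v : V) : Prop :=
  ∃ e ∈ M, v ∈ e

/-- A perfect matching of `G`: a matching saturating every vertex. -/
def IsPerfectGMatching (G : SimpleGraph V) (M : Finset (Sym2 V)) : Prop :=
  IsGMatching G M ∧ ∀ v : V, MSaturates M v

/-- The set of vertices saturated by `M`. -/
noncomputable def msupp (M : Finset (Sym2 V)) : Finset V :=
  Finset.univ.filter fun v => ∃ e ∈ M, v ∈ e

/-- `M` is a uniquely restricted matching: it is the unique perfect matching of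
the subgraph of `G` induced by the set of vertices saturated by `M`. -/
def UniquelyRestricted (G : SimpleGraph V) (M : Finset (Sym2 V)) : Prop :=
  IsGMatching G M ∧
    ∀ M' : Finset (Sym2 V), IsGMatchingOn G (msupp M) M' →
      (∀ v ∈ msupp M, MSaturates M' v) → M' = M

/-- Accessibility property of a set system. -/
def AccessibleFam (F : Set (Finset V)) : Prop :=
  ∀ X ∈ F, X ≠ ∅ → ∃ x ∈ X, X.erase x ∈ F

/-- Exchange property of a set system. -/
def ExchangeFam (F : Set (Finset V)) : Prop :=
  ∀ X ∈ F, ∀ Y ∈ F, X.card = Y.card + 1 → ∃ x ∈ X, x ∉ Y ∧ insert x Y ∈ F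

/-- A greedoid: a nonempty set system satisfying accessibility and exchange. -/
def IsGreedoidFam (F : Set (Finset V)) : Prop :=
  F.Nonempty ∧ AccessibleFam F ∧ ExchangeFam F

/-- A maximal stable set. -/
def IsMaximalStable (G : SimpleGraph V) (S : Finset V) : Prop :=
  IsStable G S ∧ ∀ T, IsStable G T → S ⊆ T → S = T

/-- `G` is well-covered: all maximal stable sets have the same cardinality. -/
def WellCovered (G : SimpleGraph V) : Prop :=
  ∀ S T, IsMaximalStable G S → IsMaximalStable G T → S.card = T.card

/-- `G` is very well-covered: well-covered, no isolated vertices, `|V| = 2α(G)`. -/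
def VeryWellCovered (G : SimpleGraph V) : Prop :=
  WellCovered G ∧ (∀ v : V, ∃ u, G.Adj v u) ∧ Fintype.card V = 2 * alpha G

/-- The subgraph of `G` induced by `A` is a König-Egerváry graph. -/
def KonigEgervaryOn (G : SimpleGraph V) (A : Finset V) : Prop :=
  alphaOn G A + muOn G A = A.card

/-- `G` is a König-Egerváry graph: `α(G) + μ(G) = |V(G)|`. -/
def KonigEgervary (G : SimpleGraph V) : Prop :=
  alpha G + mu G = Fintype.card V

/-- The cycle `c` is alternating with respect to `M`: of every two incident
edges of `c` exactly one belongs to `M`. -/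
def IsAlternatingCycle (G : SimpleGraph V) (M : Finset (Sym2 V)) {v : V}
    (c : G.Walk v v) : Prop :=
  c.IsCycle ∧ ∀ e ∈ c.edges, ∀ f ∈ c.edges, e ≠ f →
    (∃ u : V, u ∈ e ∧ u ∈ f) → (e ∈ M ↔ f ∉ M)

/-- `G` contains an `M`-alternating cycle. -/
def HasAlternatingCycle (G : SimpleGraph V) (M : Finset (Sym2 V)) : Prop :=
  ∃ (v : V) (c : G.Walk v v), IsAlternatingCycle G M c

/-- The cycle `c` is chordless: the subgraph induced by its vertices has no
edges other than the cycle edges. -/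
def ChordlessCycle (G : SimpleGraph V) {v : V} (c : G.Walk v v) : Prop :=
  ∀ x ∈ c.support, ∀ y ∈ c.support, G.Adj x y → s(x, y) ∈ c.edges

/-- `f` is the partner map of a perfect matching of `G`. -/
structure IsPartnerMap (G : SimpleGraph V) (f : V → V) : Prop where
  invol : ∀ v, f (f v) = v
  adj : ∀ v, G.Adj v (f v)

theorem IsPartnerMap.injective {W : Type*} {G : SimpleGraph W} {f : W → W}
    (hf : IsPartnerMap G f) : Function.Injective f :=
  Function.LeftInverse.injective hf.invol

/-- The set of edges joining each vertex to its partner. -/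
def partnerEdges (f : V → V) : Finset (Sym2 V) :=
  Finset.univ.image fun v => s(v, f v)

theorem mk_mem_partnerEdges {f : V → V} (hf : ∀ v, f (f v) = v) {v w : V} :
    s(v, w) ∈ partnerEdges f ↔ w = f v := by
  simp only [partnerEdges, Finset.mem_image, Finset.mem_univ, true_and, Sym2.eq_iff]
  constructor
  · rintro ⟨a, ⟨rfl, rfl⟩ | ⟨rfl, rfl⟩⟩
    · rfl
    · exact (hf a).symm
  · rintro rfl
    exact ⟨v, Or.inl ⟨rfl, rfl⟩⟩

theorem IsPartnerMap.isPerfectGMatching {G : SimpleGraph V} {f : V → V}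
    (hf : IsPartnerMap G f) : IsPerfectGMatching G (partnerEdges f) := by
  refine ⟨⟨?_, ?_⟩, fun v => ⟨s(v, f v), (mk_mem_partnerEdges hf.invol).2 rfl, by simp⟩⟩
  · intro e he
    obtain ⟨v, -, rfl⟩ := Finset.mem_image.1 he
    exact hf.adj v
  · intro e he e' he' hne v hv hv'
    obtain ⟨a, rfl⟩ := hv
    obtain ⟨b, rfl⟩ := hv'
    rw [mk_mem_partnerEdges hf.invol] at he he'
    exact hne (by rw [he, he'])

theorem IsPerfectGMatching.exists_partnerMap {G : SimpleGraph V} {M : Finset (Sym2 V)}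
    (hM : IsPerfectGMatching G M) : ∃ f, IsPartnerMap G f ∧ M = partnerEdges f := by
  have hex : ∀ v, ∃ w, s(v, w) ∈ M := by
    intro v
    obtain ⟨e, he, w, rfl⟩ := hM.2 v
    exact ⟨w, he⟩
  choose f hf using hex
  have huniq : ∀ v w, s(v, w) ∈ M → w = f v := by
    intro v w h
    by_contra hne
    exact hM.1.2 _ h _ (hf v) (fun h => hne (Sym2.congr_right.1 h)) v (by simp) (by simp)
  have hinv : ∀ v, f (f v) = v := fun v =>
    (huniq (f v) v (by rw [Sym2.eq_swap]; exact hf v)).symm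
  refine ⟨f, ⟨hinv, fun v => hM.1.1 _ (hf v)⟩, ?_⟩
  ext e
  induction e with
  | _ v w =>
    rw [mk_mem_partnerEdges hinv]
    exact ⟨huniq v w, fun h => h ▸ hf v⟩

theorem IsStable.mono {W : Type*} {G : SimpleGraph W} {S T : Finset W}
    (hT : IsStable G T) (h : S ⊆ T) : IsStable G S :=
  fun _ hx _ hy => hT (h hx) (h hy)

theorem bddAbove_card_stable {W : Type*} (G : SimpleGraph W) (A : Finset W) :
    BddAbove {n | ∃ S ⊆ A, IsStable G S ∧ S.card = n} := by
  refine ⟨A.card, ?_⟩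
  rintro n ⟨S, hS, -, rfl⟩
  exact Finset.card_le_card hS

theorem IsStable.card_le_alphaOn {W : Type*} {G : SimpleGraph W} {S A : Finset W}
    (hS : IsStable G S) (h : S ⊆ A) : S.card ≤ alphaOn G A :=
  le_csSup (bddAbove_card_stable G A) ⟨S, h, hS, rfl⟩

theorem exists_stable_card_eq_alphaOn {W : Type*} (G : SimpleGraph W) (A : Finset W) :
    ∃ S ⊆ A, IsStable G S ∧ S.card = alphaOn G A :=
  Nat.sSup_mem (s := {n | ∃ S ⊆ A, IsStable G S ∧ S.card = n})
    ⟨0, ∅, by simp, fun _ hx => by simp at hx, rfl⟩ (bddAbove_card_stable G A)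

theorem IsStable.card_le_alpha {W : Type*} [Fintype W] {G : SimpleGraph W} {S : Finset W}
    (hS : IsStable G S) : S.card ≤ alpha G :=
  hS.card_le_alphaOn (Finset.subset_univ S)

/-- In a well-covered graph every stable set extends to a maximum one. -/
theorem WellCovered.exists_superset_card_eq_alpha {G : SimpleGraph V} (hG : WellCovered G)
    {A : Finset V} (hA : IsStable G A) : ∃ T, A ⊆ T ∧ IsStable G T ∧ T.card = alpha G := by
  obtain ⟨T, hAT, hT⟩ := (Set.toFinite {T | IsStable G T}).exists_le_maximal hA
  obtain ⟨S, -, hS, hScard⟩ := exists_stable_card_eq_alphaOn G Finset.univ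
  refine ⟨T, hAT, hT.1, (hG T S ⟨hT.1, fun U hU h => h.antisymm (hT.2 hU h)⟩
    ⟨hS, fun U hU h => Finset.eq_of_subset_of_card_le h ?_⟩).trans hScard⟩
  rw [hScard]
  exact hU.card_le_alpha

/-- Hall's condition for stable sets of a well-covered graph without isolated vertices. -/
theorem WellCovered.card_le_card_nbhd {G : SimpleGraph V} (hG : WellCovered G)
    (hiso : ∀ v, ∃ u, G.Adj v u) {A : Finset V} (hA : IsStable G A) :
    A.card ≤ (nbhd G A).card := by
  induction A using Finset.strongInduction with
  | H A ih =>
    obtain rfl | ⟨a, ha⟩ := A.eq_empty_or_nonempty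
    · simp
    obtain ⟨v, hv⟩ := hiso a
    have hvs : IsStable G {v} := by
      intro x hx y hy
      simp only [Finset.mem_singleton] at hx hy
      subst hx hy
      exact G.irrefl
    obtain ⟨T, hvT, hT, hTcard⟩ := hG.exists_superset_card_eq_alpha hvs
    have hvT : v ∈ T := hvT (by simp)
    have hlt : A ∩ T ⊂ A := by
      refine ⟨Finset.inter_subset_left, fun h => ?_⟩
      exact hT (Finset.mem_inter.1 (h ha)).2 hvT hv
    have hle := ih _ hlt (hA.mono hlt.1)
    have hswap : IsStable G ((T \ nbhd G A) ∪ A) := by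
      intro x hx y hy hxy
      have h₁ := @hT x
      have h₂ := @hA x
      have h₃ := hxy.symm
      simp only [Finset.mem_union, Finset.mem_sdiff, nbhd, Finset.mem_filter,
        Finset.mem_univ, true_and] at hx hy
      grind
    have hcard := hswap.card_le_alpha
    have e₁ : (T \ nbhd G A) ∪ A = (T \ (nbhd G A ∪ A)) ∪ A := by grind
    have e₂ : T = (T \ (nbhd G A ∪ A)) ∪ ((T ∩ nbhd G A) ∪ (A ∩ T)) := by grind
    have hdA : ∀ x ∈ nbhd G A, x ∉ A := fun x hx => (Finset.mem_filter.1 hx).2.1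
    rw [← hTcard, e₁, Finset.card_union_of_disjoint (by
      rw [Finset.disjoint_left]; grind)] at hcard
    have hcT := congrArg Finset.card e₂
    rw [Finset.card_union_of_disjoint (by rw [Finset.disjoint_left]; grind),
      Finset.card_union_of_disjoint (by rw [Finset.disjoint_left]; grind)] at hcT
    have hsub : nbhd G (A ∩ T) ∪ (T ∩ nbhd G A) ⊆ nbhd G A := by
      refine Finset.union_subset (fun x hx => ?_) Finset.inter_subset_right
      simp only [nbhd, Finset.mem_filter, Finset.mem_univ, true_and, Finset.mem_inter] at hx ⊢
      obtain ⟨-, u, hu, hux⟩ := hx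
      exact ⟨fun hxA => hA hu.1 hxA hux, u, hu.1, hux⟩
    have hdisj : Disjoint (nbhd G (A ∩ T)) (T ∩ nbhd G A) := by
      rw [Finset.disjoint_left]
      intro x hx hx'
      obtain ⟨-, u, hu, hux⟩ := (Finset.mem_filter.1 hx).2
      exact hT (Finset.mem_inter.1 hu).2 (Finset.mem_inter.1 hx').1 hux
    have hfin := Finset.card_le_card hsub
    rw [Finset.card_union_of_disjoint hdisj] at hfin
    omega

theorem VeryWellCovered.exists_partnerMap {G : SimpleGraph V} (hG : VeryWellCovered G) :
    ∃ f, IsPartnerMap G f := by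
  obtain ⟨hwc, hiso, hcard⟩ := hG
  obtain ⟨S, -, hS, hScard⟩ := exists_stable_card_eq_alphaOn G Finset.univ
  change S.card = alpha G at hScard
  obtain ⟨g, hginj, hg⟩ := (Finset.all_card_le_biUnion_card_iff_exists_injective
    (fun s : S => Finset.univ.filter fun v => G.Adj s v)).1 (by
      intro A
      have hA : IsStable G (A.map (Function.Embedding.subtype _)) := hS.mono (by
        intro x hx
        obtain ⟨y, -, rfl⟩ := Finset.mem_map.1 hx
        exact y.2)
      have h := hwc.card_le_card_nbhd hiso hA
      rw [Finset.card_map] at h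
      refine h.trans (Finset.card_le_card fun x hx => ?_)
      obtain ⟨-, u, hu, hux⟩ := (Finset.mem_filter.1 hx).2
      obtain ⟨y, hy, rfl⟩ := Finset.mem_map.1 hu
      exact Finset.mem_biUnion.2 ⟨y, hy, by simpa using hux⟩)
  have hgadj : ∀ s : S, G.Adj s (g s) := fun s => by simpa using hg s
  have himage : Finset.univ.image g = Sᶜ := by
    apply Finset.eq_of_subset_of_card_le
    · intro x hx
      obtain ⟨s, -, rfl⟩ := Finset.mem_image.1 hx
      exact Finset.mem_compl.2 fun h => hS s.2 h (hgadj s)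
    · rw [Finset.card_compl, Finset.card_image_of_injective _ hginj, Finset.card_univ,
        Fintype.card_coe]
      omega
  have hpre : ∀ v, v ∉ S → ∃ s : S, g s = v := by
    intro v hv
    have : v ∈ Finset.univ.image g := by rw [himage]; exact Finset.mem_compl.2 hv
    obtain ⟨s, -, hs⟩ := Finset.mem_image.1 this
    exact ⟨s, hs⟩
  choose k hk using hpre
  refine ⟨fun v => if h : v ∈ S then g ⟨v, h⟩ else k v h, fun v => ?_, fun v => ?_⟩
  · by_cases h : v ∈ S
    · have hn : g ⟨v, h⟩ ∉ S := fun h' => hS h h' (hgadj ⟨v, h⟩)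
      simp only [h, hn, dite_true, dite_false]
      rw [hginj (hk _ hn)]
    · simp [h, hk]
  · by_cases h : v ∈ S
    · simpa [h] using hgadj ⟨v, h⟩
    · simp only [h, dite_false]
      have := hgadj (k v h)
      rw [hk] at this
      exact this.symm

theorem IsPartnerMap.mem_or_mem {G : SimpleGraph V} {f : V → V} (hf : IsPartnerMap G f)
    (hcard : Fintype.card V = 2 * alpha G) {S : Finset V} (hS : IsStable G S)
    (hScard : S.card = alpha G) (x : V) : x ∈ S ∨ f x ∈ S := by
  have hdisj : Disjoint S (S.image f) := by
    rw [Finset.disjoint_left]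
    intro y hy hy'
    obtain ⟨z, hz, rfl⟩ := Finset.mem_image.1 hy'
    exact hS hz hy (hf.adj z)
  have huniv : S ∪ S.image f = Finset.univ := by
    rw [← Finset.card_eq_iff_eq_univ, Finset.card_union_of_disjoint hdisj,
      Finset.card_image_of_injective _ hf.injective]
    omega
  have hx : x ∈ S ∪ S.image f := huniv ▸ Finset.mem_univ x
  rcases Finset.mem_union.1 hx with h | h
  · exact Or.inl h
  · obtain ⟨y, hy, rfl⟩ := Finset.mem_image.1 h
    exact Or.inr (by rwa [hf.invol])

/-- Favaron's property of the perfect matchings of a very well-covered graph. -/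
theorem IsPartnerMap.adj_of_adj {G : SimpleGraph V} {f : V → V} (hf : IsPartnerMap G f)
    (hG : VeryWellCovered G) {u x w : V} (hu : G.Adj u x) (hw : G.Adj w (f x)) :
    G.Adj u w := by
  by_contra h
  have hst : IsStable G {u, w} := by
    intro a ha b hb
    have := h ∘ G.adj_symm
    simp only [Finset.mem_insert, Finset.mem_singleton] at ha hb
    rcases ha with rfl | rfl <;> rcases hb with rfl | rfl <;> simp_all
  obtain ⟨T, hsub, hT, hTcard⟩ := hG.1.exists_superset_card_eq_alpha hst
  rcases hf.mem_or_mem hG.2.2 hT hTcard x with hx | hx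
  · exact hT (hsub (by simp)) hx hu
  · exact hT (hsub (by simp)) hx hw

theorem IsPartnerMap.not_adj {G : SimpleGraph V} {f : V → V} (hf : IsPartnerMap G f)
    (hG : VeryWellCovered G) {s t : V} (h : G.Adj s (f t)) : ¬G.Adj s t :=
  fun h' => G.irrefl (hf.adj_of_adj hG h' h)

theorem IsPartnerMap.adj_trans {G : SimpleGraph V} {f : V → V} (hf : IsPartnerMap G f)
    (hG : VeryWellCovered G) {s t r : V} (hst : G.Adj s (f t)) (htr : G.Adj t (f r)) :
    G.Adj s (f r) :=
  (hf.adj_of_adj hG htr.symm hst).symm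

/-- With respect to a perfect matching with partner map `f`, the local maximum stable sets are
the stable sets closed under the preorder `s ≤ t ↔ G.Adj s (f t)`. -/
theorem IsPartnerMap.mem_Psi_iff {G : SimpleGraph V} {f : V → V} (hf : IsPartnerMap G f)
    (hG : VeryWellCovered G) {S : Finset V} :
    S ∈ Psi G ↔ IsStable G S ∧ ∀ s ∈ S, ∀ u, G.Adj s u → f u ∈ S := by
  constructor
  · rintro ⟨hS, hcard⟩
    refine ⟨hS, fun s hs z hsz => ?_⟩
    by_contra hz
    have hzS : z ∉ S := fun h => hS hs h hsz
    let B := S.filter fun t => G.Adj z t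
    have hB : ∀ t, t ∈ B ↔ t ∈ S ∧ G.Adj z t := fun t => Finset.mem_filter
    have hfB : ∀ t ∈ B, ∀ w, G.Adj (f t) w → G.Adj z w := fun t ht w hw =>
      hf.adj_of_adj hG ((hB t).1 ht).2 hw.symm
    have hzfB : ∀ t ∈ B, ¬G.Adj z (f t) := fun t ht h => G.irrefl (hfB t ht z h.symm)
    have hBf : ∀ x, x ∈ B.image f ↔ ∃ t ∈ B, f t = x := fun x => Finset.mem_image
    have hT : IsStable G (insert z ((S \ B) ∪ B.image f)) := by
      intro x hx y hy hxy
      have hyx := hxy.symm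
      simp only [Finset.mem_insert, Finset.mem_union, Finset.mem_sdiff, hBf] at hx hy
      rcases hx with rfl | ⟨hx, hxB⟩ | ⟨t, ht, rfl⟩ <;>
      rcases hy with rfl | ⟨hy, hyB⟩ | ⟨r, hr, rfl⟩
      · exact G.irrefl hxy
      · exact hyB ((hB y).2 ⟨hy, hxy⟩)
      · exact hzfB r hr hxy
      · exact hxB ((hB x).2 ⟨hx, hyx⟩)
      · exact hS hx hy hxy
      · exact hxB ((hB x).2 ⟨hx, hfB r hr x hyx⟩)
      · exact hzfB t ht hyx
      · exact hyB ((hB y).2 ⟨hy, hfB t ht y hxy⟩)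
      · exact hzfB r hr (hfB t ht _ hxy)
    have hsub : insert z ((S \ B) ∪ B.image f) ⊆ closedNbhd G S := by
      intro x hx
      simp only [closedNbhd, nbhd, Finset.mem_union, Finset.mem_filter, Finset.mem_univ,
        true_and]
      simp only [Finset.mem_insert, Finset.mem_union, Finset.mem_sdiff, hBf] at hx
      rcases hx with rfl | ⟨hx, -⟩ | ⟨t, ht, rfl⟩
      · exact Or.inr ⟨hzS, s, hs, hsz⟩
      · exact Or.inl hx
      · have htS := ((hB t).1 ht).1
        exact Or.inr ⟨fun h => hS htS h (hf.adj t), t, htS, hf.adj t⟩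
    have hle := hT.card_le_alphaOn hsub
    rw [← hcard, Finset.card_insert_of_notMem, Finset.card_union_of_disjoint,
      Finset.card_image_of_injective _ hf.injective,
      Finset.card_sdiff_add_card_eq_card (Finset.filter_subset _ _)] at hle
    · omega
    · rw [Finset.disjoint_left]
      intro x hx hx'
      obtain ⟨t, ht, rfl⟩ := (hBf x).1 hx'
      exact hS ((hB t).1 ht).1 (Finset.mem_sdiff.1 hx).1 (hf.adj t)
    · intro h
      simp only [Finset.mem_union, Finset.mem_sdiff, hBf] at h
      rcases h with h | ⟨t, ht, rfl⟩
      · exact hzS h.1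
      · rw [hf.invol] at hz
        exact hz ((hB t).1 ht).1
  · rintro ⟨hS, hcl⟩
    refine ⟨hS, le_antisymm (hS.card_le_alphaOn Finset.subset_union_left) ?_⟩
    obtain ⟨T, hsub, hT, hTcard⟩ := exists_stable_card_eq_alphaOn G (closedNbhd G S)
    rw [← hTcard]
    refine Finset.card_le_card_of_injOn (fun t => if t ∈ S then t else f t) ?_ ?_
    · intro t ht
      by_cases h : t ∈ S
      · simp [h]
      · have := hsub ht
        simp only [closedNbhd, nbhd, Finset.mem_union, Finset.mem_filter, Finset.mem_univ,
          true_and, h, false_or] at this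
        obtain ⟨-, u, hu, hut⟩ := this
        simpa [h] using hcl u hu t hut
    · intro t ht r hr heq
      have h₁ : f t ≠ r := fun h => hT ht hr (h ▸ hf.adj t)
      have h₂ : f r ≠ t := fun h => hT hr ht (h ▸ hf.adj r)
      have h₃ : f t = f r → t = r := fun h => hf.injective h
      grind

theorem IsPartnerMap.filter_mem_Psi {G : SimpleGraph V} {f : V → V} (hf : IsPartnerMap G f)
    (hG : VeryWellCovered G) (s : V) : (Finset.univ.filter fun t => G.Adj s (f t)) ∈ Psi G := by
  rw [hf.mem_Psi_iff hG]
  constructor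
  · intro t ht r hr htr
    rw [Finset.mem_filter] at ht hr
    exact hf.not_adj hG hr.2 (hf.adj_of_adj hG htr.symm ht.2).symm
  · intro t ht u htu
    rw [Finset.mem_filter] at ht ⊢
    refine ⟨Finset.mem_univ _, hf.adj_trans hG ht.2 ?_⟩
    rwa [hf.invol]

/-- Antisymmetry of the preorder `s ≤ t ↔ G.Adj s (f t)`, i.e. absence of alternating
4-cycles. -/
def PartnerAntisymm (G : SimpleGraph V) (f : V → V) : Prop :=
  ∀ s t, G.Adj s (f t) → G.Adj t (f s) → s = t

theorem IsPartnerMap.antisymm_of_accessible {G : SimpleGraph V} {f : V → V}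
    (hf : IsPartnerMap G f) (hG : VeryWellCovered G) (hacc : AccessibleFam (Psi G)) :
    PartnerAntisymm G f := by
  intro s t hst hts
  by_contra hne
  obtain ⟨X, ⟨hX, hsX⟩, hmin⟩ := Set.exists_min_image {X | X ∈ Psi G ∧ s ∈ X} Finset.card
    (Set.toFinite _) ⟨_, hf.filter_mem_Psi hG s, by simpa using hf.adj s⟩
  obtain ⟨x, hx, hxX⟩ := hacc X hX (Finset.ne_empty_of_mem hsX)
  have hcl := ((hf.mem_Psi_iff hG).1 hX).2
  have hcl' := ((hf.mem_Psi_iff hG).1 hxX).2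
  have htX : t ∈ X := by simpa [hf.invol] using hcl s hsX _ hst
  by_cases hxs : x = s
  · subst hxs
    have := hcl' t (Finset.mem_erase.2 ⟨Ne.symm hne, htX⟩) _ hts
    simp [hf.invol] at this
  · exact absurd (hmin _ ⟨hxX, Finset.mem_erase.2 ⟨Ne.symm hxs, hsX⟩⟩)
      (not_le.2 (Finset.card_erase_lt_of_mem hx))

theorem IsPartnerMap.eq_of_antisymm {G : SimpleGraph V} {f g : V → V} (hf : IsPartnerMap G f)
    (hG : VeryWellCovered G) (hanti : PartnerAntisymm G f) (hg : IsPartnerMap G g) : g = f := by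
  funext s
  have hiter : ∀ n s, G.Adj s (f ((f ∘ g)^[n] s)) := by
    intro n
    induction n with
    | zero => exact hf.adj
    | succ n ih =>
      intro s
      rw [Function.iterate_succ_apply]
      refine hf.adj_trans hG (t := f (g s)) ?_ (ih _)
      rw [hf.invol]
      exact hg.adj s
  have hper := (hf.injective.comp hg.injective).mem_periodicPts s
  obtain ⟨n, hn, hns⟩ := hper
  obtain ⟨m, rfl⟩ := Nat.exists_eq_succ_of_ne_zero hn.ne'
  have h₁ : (f ∘ g)^[m] (f (g s)) = s := hns
  have h₂ := hiter m (f (g s))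
  rw [h₁] at h₂
  have h₃ := hanti s (f (g s)) (by rw [hf.invol]; exact hg.adj s) h₂
  calc g s = f (f (g s)) := (hf.invol _).symm
    _ = f s := by rw [← h₃]

theorem IsPartnerMap.antisymm_of_unique {W : Type*} {G : SimpleGraph W} {f : W → W}
    (hf : IsPartnerMap G f) (huniq : ∀ g, IsPartnerMap G g → g = f) :
    PartnerAntisymm G f := by
  intro s t hst hts
  by_contra hne
  have hinv := hf.invol
  have n₁ := (hf.adj s).ne
  have n₂ := (hf.adj t).ne
  have n₃ := hst.ne
  have n₄ := hts.ne
  have n₅ := hf.injective.ne hne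
  let g : W → W := fun v =>
    if v = s then f t else if v = t then f s else if v = f s then t else if v = f t then s
    else f v
  have hg : IsPartnerMap G g := by
    refine ⟨fun v => ?_, fun v => ?_⟩
    · have := hinv v
      have := hinv s
      have := hinv t
      grind
    · have := hf.adj v
      have := hst.symm
      have := hts.symm
      simp only [g]
      split_ifs <;> simp_all
  have := congrFun (huniq g hg) s
  simp only [g, if_true] at this
  exact n₅ this.symm

theorem IsPartnerMap.isGreedoidFam {G : SimpleGraph V} {f : V → V} (hf : IsPartnerMap G f)
    (hG : VeryWellCovered G) (hanti : PartnerAntisymm G f) : IsGreedoidFam (Psi G) := by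
  let P : PartialOrder V :=
    { le := fun s t => G.Adj s (f t)
      le_refl := hf.adj
      le_trans := fun _ _ _ => hf.adj_trans hG
      le_antisymm := hanti }
  refine ⟨⟨∅, (hf.mem_Psi_iff hG).2 ⟨fun _ h => by simp at h, fun _ h => by simp at h⟩⟩, ?_, ?_⟩
  · intro X hX hne
    obtain ⟨x, hx⟩ := X.exists_minimal (Finset.nonempty_iff_ne_empty.2 hne)
    obtain ⟨hS, hcl⟩ := (hf.mem_Psi_iff hG).1 hX
    refine ⟨x, hx.1, (hf.mem_Psi_iff hG).2 ⟨hS.mono (Finset.erase_subset _ _), ?_⟩⟩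
    intro s hs u hsu
    obtain ⟨hsx, hsX⟩ := Finset.mem_erase.1 hs
    refine Finset.mem_erase.2 ⟨?_, hcl s hsX u hsu⟩
    rintro rfl
    have hle : s ≤ f u := by
      change G.Adj s (f (f u))
      rwa [hf.invol]
    exact hsx (le_antisymm hle (hx.2 hsX hle))
  · intro X hX Y hY hcard
    obtain ⟨hXs, hXcl⟩ := (hf.mem_Psi_iff hG).1 hX
    obtain ⟨hYs, hYcl⟩ := (hf.mem_Psi_iff hG).1 hY
    have hne : (X.filter fun x => x ∉ Y ∧ f x ∉ Y).Nonempty := by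
      by_contra hempty
      rw [Finset.not_nonempty_iff_eq_empty, Finset.filter_eq_empty_iff] at hempty
      have : X.card ≤ Y.card := by
        refine Finset.card_le_card_of_injOn (fun t => if t ∈ Y then t else f t) ?_ ?_
        · intro t ht
          have := hempty ht
          simp only [Finset.mem_coe]
          split_ifs <;> tauto
        · intro t ht r hr heq
          have h₁ : f t ≠ r := fun h => hXs ht hr (h ▸ hf.adj t)
          have h₂ : f r ≠ t := fun h => hXs hr ht (h ▸ hf.adj r)
          have h₃ : f t = f r → t = r := fun h => hf.injective h
          grind
      omega
    obtain ⟨x, hx⟩ := Finset.exists_maximal hne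
    obtain ⟨hxX, hxY, hfxY⟩ := Finset.mem_filter.1 hx.1
    have hxadj : ∀ y ∈ Y, ¬G.Adj y x := fun y hy h => hfxY (hYcl y hy x h)
    refine ⟨x, hxX, hxY, (hf.mem_Psi_iff hG).2 ⟨?_, ?_⟩⟩
    · intro a ha b hb hab
      rw [Finset.mem_insert] at ha hb
      rcases ha with rfl | ha <;> rcases hb with rfl | hb
      · exact G.irrefl hab
      · exact hxadj b hb hab.symm
      · exact hxadj a ha hab
      · exact hYs ha hb hab
    · intro s hs u hsu
      rw [Finset.mem_insert] at hs ⊢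
      rcases hs with rfl | hs
      · by_contra! hu
        have huY : u ∉ Y := fun h => hxadj u h hsu.symm
        have hle : s ≤ f u := by
          change G.Adj s (f (f u))
          rwa [hf.invol]
        refine hu.1 (le_antisymm (hx.2 (Finset.mem_filter.2
          ⟨hXcl s hxX u hsu, hu.2, by rwa [hf.invol]⟩) hle) hle)
      · exact Or.inr (hYcl s hs u hsu)

/-- For a very well-covered graph `G`, the family `Ψ(G)` forms a
greedoid on `V(G)` iff `G` has a unique perfect matching. -/
theorem psi_greedoid_iff_unique_perfect_matching (G : SimpleGraph V)
    (hG : VeryWellCovered G) :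
    IsGreedoidFam (Psi G) ↔ ∃! M : Finset (Sym2 V), IsPerfectGMatching G M := by
  obtain ⟨f, hf⟩ := hG.exists_partnerMap
  constructor
  · rintro ⟨-, hacc, -⟩
    have hanti := hf.antisymm_of_accessible hG hacc
    refine ⟨partnerEdges f, hf.isPerfectGMatching, fun M hM => ?_⟩
    obtain ⟨g, hg, rfl⟩ := hM.exists_partnerMap
    rw [hf.eq_of_antisymm hG hanti hg]
  · intro huniq
    refine hf.isGreedoidFam hG (hf.antisymm_of_unique fun g hg => funext fun v => ?_)
    rw [← mk_mem_partnerEdges hf.invol,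
      huniq.unique hf.isPerfectGMatching hg.isPerfectGMatching, mk_mem_partnerEdges hg.invol]
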